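/- arXiv:2604.14347 — 8 statements merged into one kernel-verified Lean document; each statement's English description precedes it below -/
import Mathlib

section
/- For every integer m ≥ 1 and every integer i ≥ 0, the matrix G^(m)_i equals the sum ∑_{(k_1,…,k_m) ∈ K_m(i)} A_{k_1} A_{k_2} ⋯ A_{k_m} A_{−1} (a sum over the finite set K_m(i), with matrix products taken left to right); in particular, G^(m)_i = 0 whenever i > m. -/
open scoped BigOperators

/-- The admissible step-set `K_m(i)`: tuples `(k_1, …, k_m)` of integers with each
`k_j ≥ -1`, all partial sums `i + k_1 + ⋯ + k_u ≥ 0` for `1 ≤ u ≤ m`, and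
`i + k_1 + ⋯ + k_m = 0`. -/
def Kset (m i : ℕ) : Set (Fin m → ℤ) :=
  {k | (∀ j, -1 ≤ k j) ∧
       (∀ u, 1 ≤ u → u ≤ m →
         0 ≤ (i : ℤ) + ∑ j ∈ Finset.univ.filter (fun j : Fin m => (j : ℕ) < u), k j) ∧
       (i : ℤ) + ∑ j, k j = 0}

lemma sum_filter_val_lt_succ {M : Type*} [AddCommMonoid M] (m u : ℕ) (k : Fin (m + 1) → M) :
    ∑ j ∈ Finset.univ.filter (fun j : Fin (m + 1) => (j : ℕ) < u + 1), k j =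
      k 0 + ∑ j ∈ Finset.univ.filter (fun j : Fin m => (j : ℕ) < u), k j.succ := by
  simp [Finset.sum_filter, Fin.sum_univ_succ]

lemma le_of_mem_Kset {m i : ℕ} {k : Fin m → ℤ} (hk : k ∈ Kset m i) : i ≤ m := by
  obtain ⟨h1, -, h3⟩ := hk
  have h : ∑ _j : Fin m, (-1 : ℤ) ≤ ∑ j, k j := Finset.sum_le_sum fun j _ => h1 j
  simp at h
  omega

lemma cons_mem_Kset_iff {m i t : ℕ} {k : Fin m → ℤ} :
    (Fin.cons ((t : ℤ) - i) k : Fin (m + 1) → ℤ) ∈ Kset (m + 1) i ↔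
      i ≤ t + 1 ∧ k ∈ Kset m t := by
  constructor
  · rintro ⟨h1, h2, h3⟩
    refine ⟨?_, fun j => by simpa using h1 j.succ, fun u hu hum => ?_, ?_⟩
    · have := h1 0
      simp only [Fin.cons_zero] at this
      omega
    · have := h2 (u + 1) (by omega) (by omega)
      rw [sum_filter_val_lt_succ] at this
      simp only [Fin.cons_zero, Fin.cons_succ] at this
      omega
    · rw [Fin.sum_univ_succ] at h3
      simp only [Fin.cons_zero, Fin.cons_succ] at h3
      omega
  · rintro ⟨h0, h1, h2, h3⟩
    refine ⟨fun j => ?_, fun u hu hum => ?_, ?_⟩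
    · cases j using Fin.cases with
      | zero =>
        simp only [Fin.cons_zero]
        omega
      | succ j => simpa using h1 j
    · obtain ⟨u, rfl⟩ := Nat.exists_eq_add_of_le' hu
      rw [sum_filter_val_lt_succ]
      simp only [Fin.cons_zero, Fin.cons_succ]
      rcases Nat.eq_zero_or_pos u with rfl | hu'
      · simp
      · have := h2 u hu' (by omega)
        omega
    · rw [Fin.sum_univ_succ]
      simp only [Fin.cons_zero, Fin.cons_succ]
      omega

lemma Kset_succ (m i : ℕ) :
    Kset (m + 1) i = ⋃ t ∈ {t : ℕ | t ≤ m ∧ i ≤ t + 1},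
      (fun k : Fin m → ℤ => (Fin.cons ((t : ℤ) - i) k : Fin (m + 1) → ℤ)) '' Kset m t := by
  ext k
  simp only [Set.mem_iUnion, Set.mem_image, Set.mem_ofPred_eq, exists_prop]
  constructor
  · intro hk
    have h0 : 0 ≤ (i : ℤ) + k 0 := by
      have := hk.2.1 (0 + 1) le_rfl (by omega)
      rw [sum_filter_val_lt_succ] at this
      simpa using this
    obtain ⟨t, ht⟩ := Int.eq_ofNat_of_zero_le h0
    have hcons : (Fin.cons ((t : ℤ) - i) (Fin.tail k) : Fin (m + 1) → ℤ) = k := by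
      rw [← ht, add_sub_cancel_left, Fin.cons_self_tail]
    rw [← hcons, cons_mem_Kset_iff] at hk
    exact ⟨t, ⟨le_of_mem_Kset hk.2, hk.1⟩, Fin.tail k, hk.2, hcons⟩
  · rintro ⟨t, ⟨-, hi⟩, k', hk', rfl⟩
    exact cons_mem_Kset_iff.2 ⟨hi, hk'⟩

lemma Kset_finite (m i : ℕ) : (Kset m i).Finite := by
  induction m generalizing i with
  | zero => exact Set.toFinite _
  | succ m ih =>
    rw [Kset_succ]
    exact ((Set.finite_Iic m).subset fun t ht => ht.1).biUnion fun t _ => (ih t).image _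

lemma finsum_mem_Kset_succ {M : Type*} [AddCommMonoid M] (m i : ℕ)
    (f : (Fin (m + 1) → ℤ) → M) :
    ∑ᶠ k ∈ Kset (m + 1) i, f k =
      ∑ t ∈ (Finset.range (m + 1)).filter (fun t => i ≤ t + 1),
        ∑ᶠ k ∈ Kset m t, f (Fin.cons ((t : ℤ) - i) k) := by
  rw [Kset_succ, finsum_mem_biUnion]
  · rw [← finsum_mem_coe_finset]
    refine finsum_mem_congr (by ext; simp) fun t _ => ?_
    exact finsum_mem_image (Fin.cons_right_injective (α := fun _ => ℤ) _).injOn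
  · intro t _ t' _ hne
    refine Set.disjoint_left.2 ?_
    rintro _ ⟨k, -, rfl⟩ ⟨k', -, h⟩
    have := congrFun h 0
    simp only [Fin.cons_zero] at this
    omega
  · exact (Set.finite_Iic m).subset fun t ht => ht.1
  · exact fun t _ => (Kset_finite m t).image _

lemma finsum_mem_Kset_eq_zero {M : Type*} [AddCommMonoid M] {m i : ℕ} (h : m < i)
    (f : (Fin m → ℤ) → M) : ∑ᶠ k ∈ Kset m i, f k = 0 := by
  have : Kset m i = ∅ := Set.eq_empty_of_forall_notMem fun k hk => by
    have := le_of_mem_Kset hk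
    omega
  rw [this, finsum_mem_empty]

lemma eq_finsum_mem_Kset {R : Type*} [Ring R] [TopologicalSpace R]
    (A : ℤ → R) (hAz : ∀ k : ℤ, k < -1 → A k = 0) (G : ℕ → ℕ → R)
    (hG00 : G 0 0 = A (-1)) (hG0 : ∀ s, 1 ≤ s → G 0 s = 0)
    (hGrec : ∀ m s, G (m + 1) s = ∑' t : ℕ, A ((t : ℤ) - (s : ℤ)) * G m t) (m i : ℕ) :
    G m i = ∑ᶠ k ∈ Kset m i, (List.ofFn fun j : Fin m => A (k j)).prod * A (-1) := by
  induction m generalizing i with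
  | zero =>
    rcases Nat.eq_zero_or_pos i with rfl | hi
    · have : Kset 0 0 = {Fin.elim0} := by
        ext k
        simp [Kset, Subsingleton.elim k Fin.elim0]
      rw [this, finsum_mem_singleton, hG00]
      simp
    · rw [hG0 i hi, finsum_mem_Kset_eq_zero hi]
  | succ m ih =>
    rw [hGrec, finsum_mem_Kset_succ,
      tsum_eq_sum (s := (Finset.range (m + 1)).filter (fun t => i ≤ t + 1))]
    · refine Finset.sum_congr rfl fun t _ => ?_
      rw [ih t, mul_finsum_mem' _ _ (Kset_finite m t)]
      refine finsum_mem_congr rfl fun k _ => ?_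
      simp [List.ofFn_succ, mul_assoc]
    · intro t ht
      by_cases hi : i ≤ t + 1
      · have htm : m < t := by
          by_contra hle
          exact ht (by simp [hi]; omega)
        rw [ih t, finsum_mem_Kset_eq_zero htm, mul_zero]
      · rw [hAz _ (by omega), zero_mul]

theorem stmt0
    (r : ℕ) (hr : 1 ≤ r)
    (A : ℤ → Matrix (Fin r) (Fin r) ℝ)
    (hAz : ∀ k : ℤ, k < -1 → A k = 0)
    (hAnn : ∀ k α β, 0 ≤ A k α β)
    (G : ℕ → ℕ → Matrix (Fin r) (Fin r) ℝ)
    (hG00 : G 0 0 = A (-1))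
    (hG0 : ∀ s, 1 ≤ s → G 0 s = 0)
    (hGrec : ∀ m s, G (m + 1) s = ∑' t : ℕ, A ((t : ℤ) - (s : ℤ)) * G m t) :
    ∀ m, 1 ≤ m → ∀ i : ℕ,
      (Kset m i).Finite ∧
      G m i = ∑ᶠ k ∈ Kset m i, (List.ofFn fun j : Fin m => A (k j)).prod * A (-1) ∧
      (m < i → G m i = 0) := by
  intro m _ i
  have h := eq_finsum_mem_Kset A hAz G hG00 hG0 hGrec m i
  exact ⟨Kset_finite m i, h, fun hi => h.trans (finsum_mem_Kset_eq_zero hi _)⟩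
end

section
/- The entrywise sum ∑_{m=0}^∞ G^(m)_0, taken in [0, ∞], has (α, β) entry equal to ∑_{k≥1} ∑ [A_{ℓ_1−ℓ_0} A_{ℓ_2−ℓ_1} ⋯ A_{ℓ_k−ℓ_{k−1}}]_{α,β}, where the inner sum ranges over all sequences ℓ_0 = 1, ℓ_1, …, ℓ_k = 0 of natural numbers with ℓ_t ≥ 1 for 0 ≤ t ≤ k−1; that is, ∑_{m=0}^∞ G^(m)_0 equals the path-sum defining the fundamental-period (first-passage) matrix G of a Markov chain of M/G/1 type from level 1 down to level 0. -/
open scoped BigOperators ENNReal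

/-- Sequences of `n + 1` steps from level `s` down to level `0`, staying in levels `≥ 1` before the
last step. -/
abbrev FirstPassagePath (n s : ℕ) : Type :=
  {f : Fin (n + 2) → ℕ //
    f 0 = s ∧ f (Fin.last (n + 1)) = 0 ∧ ∀ t : Fin (n + 1), 1 ≤ f t.castSucc}

namespace FirstPassagePath

/-- A path from level `s + 1` is the same as its second level, which is positive, together with the
remaining path. -/
def consEquiv (n s : ℕ) :
    (Σ t : ℕ, FirstPassagePath n (t + 1)) ≃ FirstPassagePath (n + 1) (s + 1) where
  toFun p := ⟨Fin.cons (s + 1) p.2.1, by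
    obtain ⟨t, g, h0, hl, hp⟩ := p
    refine ⟨rfl, ?_, ?_⟩
    · exact hl
    · intro i
      induction i using Fin.cases with
      | zero => simp
      | succ i =>
        rw [← Fin.succ_castSucc, Fin.cons_succ]
        exact hp i⟩
  invFun f := ⟨f.1 1 - 1, Fin.tail f.1, by
    obtain ⟨f, h0, hl, hp⟩ := f
    refine ⟨?_, ?_, fun i => ?_⟩
    · have h := hp 1
      have h1 : (1 : Fin (n + 2)).castSucc = (1 : Fin (n + 3)) := rfl
      rw [h1] at h
      exact (Nat.sub_add_cancel h).symm
    · simpa [Fin.tail] using hl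
    · have h := hp i.succ
      rwa [← Fin.succ_castSucc] at h⟩
  left_inv := by
    rintro ⟨t, g, h0, hl, hp⟩
    have ht : t = (Fin.cons (s + 1) g : Fin (n + 3) → ℕ) 1 - 1 := by
      have h1 : (Fin.cons (s + 1) g : Fin (n + 3) → ℕ) 1 = g 0 := rfl
      rw [h1, h0, Nat.add_sub_cancel]
    refine Sigma.ext ht.symm ?_
    refine (Subtype.heq_iff_coe_eq fun x => ?_).2
      (Fin.tail_cons (α := fun _ => ℕ) (s + 1) g)
    dsimp only
    rw [← ht]
  right_inv := by
    rintro ⟨f, h0, hl, hp⟩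
    apply Subtype.ext
    change Fin.cons (s + 1) (Fin.tail f) = f
    rw [← h0, Fin.cons_self_tail]

variable {r : ℕ} (A : ℤ → Matrix (Fin r) (Fin r) ℝ)

/-- The product of the step matrices along a path. -/
noncomputable def weight {n s : ℕ} (f : FirstPassagePath n s) : Matrix (Fin r) (Fin r) ℝ :=
  (List.ofFn fun t : Fin (n + 1) => A ((f.1 t.succ : ℤ) - (f.1 t.castSucc : ℤ))).prod

theorem weight_consEquiv {n s t : ℕ} (g : FirstPassagePath n (t + 1)) :
    weight A (consEquiv n s ⟨t, g⟩) = A ((t : ℤ) - s) * weight A g := by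
  rw [weight, List.ofFn_succ, List.prod_cons]
  congr 1
  have h : (consEquiv n s ⟨t, g⟩).1 (Fin.succ 0) = t + 1 := g.2.1
  have h' : (consEquiv n s ⟨t, g⟩).1 (Fin.castSucc 0) = s + 1 := rfl
  rw [h, h']
  congr 1
  push_cast
  ring

theorem weight_zero {s : ℕ} (f : FirstPassagePath 0 (s + 1)) :
    weight A f = A (-((s : ℤ) + 1)) := by
  have h : f.1 (Fin.succ 0) = 0 := f.2.2.1
  have h' : f.1 (Fin.castSucc 0) = s + 1 := f.2.1
  simp only [weight, List.ofFn_succ, List.ofFn_zero, List.prod_cons, List.prod_nil, mul_one]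
  rw [h, h']
  exact congrArg A (by push_cast; ring)

theorem weight_nonneg (hA : ∀ k α β, 0 ≤ A k α β) {n s : ℕ} (f : FirstPassagePath n (s + 1))
    (α β : Fin r) : 0 ≤ weight A f α β := by
  induction n generalizing s α with
  | zero =>
    rw [weight_zero]
    exact hA _ _ _
  | succ n ih =>
    obtain ⟨⟨t, g⟩, rfl⟩ := (consEquiv n s).surjective f
    rw [weight_consEquiv, Matrix.mul_apply]
    exact Finset.sum_nonneg fun γ _ => mul_nonneg (hA _ _ _) (ih g γ)

instance uniqueZero (s : ℕ) : Unique (FirstPassagePath 0 (s + 1)) where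
  default := ⟨![s + 1, 0], rfl, rfl, fun t => by
    fin_cases t
    exact Nat.succ_pos s⟩
  uniq f := by
    apply Subtype.ext
    funext i
    fin_cases i
    · exact f.2.1
    · exact f.2.2.1

end FirstPassagePath

theorem ENNReal.ofReal_matrix_mul_apply {l m n : Type*} [Fintype m] {M : Matrix l m ℝ}
    {N : Matrix m n ℝ} {i : l} {j : n} (hM : ∀ k, 0 ≤ M i k) (hN : ∀ k, 0 ≤ N k j) :
    ENNReal.ofReal ((M * N) i j) =
      ∑ k, ENNReal.ofReal (M i k) * ENNReal.ofReal (N k j) := by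
  rw [Matrix.mul_apply, ENNReal.ofReal_sum_of_nonneg fun k _ => mul_nonneg (hM k) (hN k)]
  exact Finset.sum_congr rfl fun k _ => ENNReal.ofReal_mul (hM k)

section Recursion

variable {r : ℕ} {A : ℤ → Matrix (Fin r) (Fin r) ℝ} {G : ℕ → ℕ → Matrix (Fin r) (Fin r) ℝ}

theorem recursion_eq_zero_of_lt (hAz : ∀ k : ℤ, k < -1 → A k = 0)
    (hG0 : ∀ s, 1 ≤ s → G 0 s = 0)
    (hGrec : ∀ m s, G (m + 1) s = ∑' t : ℕ, A ((t : ℤ) - (s : ℤ)) * G m t)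
    {m s : ℕ} (h : m < s) : G m s = 0 := by
  induction m generalizing s with
  | zero => exact hG0 s h
  | succ m ih =>
    rw [hGrec]
    refine (tsum_congr fun t => ?_).trans tsum_zero
    by_cases ht : m < t
    · rw [ih ht, mul_zero]
    · rw [hAz _ (by omega), zero_mul]

theorem recursion_succ_eq_sum (hAz : ∀ k : ℤ, k < -1 → A k = 0)
    (hG0 : ∀ s, 1 ≤ s → G 0 s = 0)
    (hGrec : ∀ m s, G (m + 1) s = ∑' t : ℕ, A ((t : ℤ) - (s : ℤ)) * G m t) (m s : ℕ) :
    G (m + 1) s = ∑ t ∈ Finset.range (m + 1), A ((t : ℤ) - (s : ℤ)) * G m t := by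
  rw [hGrec]
  refine tsum_eq_sum fun t ht => ?_
  rw [Finset.mem_range, not_lt] at ht
  rw [recursion_eq_zero_of_lt hAz hG0 hGrec ht, mul_zero]

theorem recursion_nonneg (hAz : ∀ k : ℤ, k < -1 → A k = 0) (hAnn : ∀ k α β, 0 ≤ A k α β)
    (hG00 : G 0 0 = A (-1)) (hG0 : ∀ s, 1 ≤ s → G 0 s = 0)
    (hGrec : ∀ m s, G (m + 1) s = ∑' t : ℕ, A ((t : ℤ) - (s : ℤ)) * G m t)
    (m s : ℕ) (α β : Fin r) : 0 ≤ G m s α β := by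
  induction m generalizing s α with
  | zero =>
    rcases s with _ | s
    · rw [hG00]
      exact hAnn _ _ _
    · simp [hG0 (s + 1)]
  | succ m ih =>
    rw [recursion_succ_eq_sum hAz hG0 hGrec, Matrix.sum_apply]
    refine Finset.sum_nonneg fun t _ => ?_
    rw [Matrix.mul_apply]
    exact Finset.sum_nonneg fun γ _ => mul_nonneg (hAnn _ _ _) (ih t γ)

theorem ofReal_recursion_eq_tsum_weight (hAz : ∀ k : ℤ, k < -1 → A k = 0)
    (hAnn : ∀ k α β, 0 ≤ A k α β) (hG00 : G 0 0 = A (-1)) (hG0 : ∀ s, 1 ≤ s → G 0 s = 0)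
    (hGrec : ∀ m s, G (m + 1) s = ∑' t : ℕ, A ((t : ℤ) - (s : ℤ)) * G m t)
    (m s : ℕ) (α β : Fin r) :
    ENNReal.ofReal (G m s α β) =
      ∑' f : FirstPassagePath m (s + 1), ENNReal.ofReal (f.weight A α β) := by
  have hGnn := recursion_nonneg hAz hAnn hG00 hG0 hGrec
  induction m generalizing s α with
  | zero =>
    simp only [FirstPassagePath.weight_zero, tsum_fintype, Fintype.sum_unique]
    rcases s with _ | s
    · simp [hG00]
    · rw [hG0 (s + 1) (by omega), hAz _ (by push_cast; omega)]
  | succ m ih =>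
    have hG : ENNReal.ofReal (G (m + 1) s α β) =
        ∑' t : ℕ, ENNReal.ofReal ((A ((t : ℤ) - s) * G m t) α β) := by
      rw [recursion_succ_eq_sum hAz hG0 hGrec, Matrix.sum_apply, ENNReal.ofReal_sum_of_nonneg]
      · refine (tsum_eq_sum fun t ht => ?_).symm
        rw [Finset.mem_range, not_lt] at ht
        rw [recursion_eq_zero_of_lt hAz hG0 hGrec ht, mul_zero]
        simp
      · intro t _
        rw [Matrix.mul_apply]
        exact Finset.sum_nonneg fun γ _ => mul_nonneg (hAnn _ _ _) (hGnn m t γ β)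
    rw [hG, ← (FirstPassagePath.consEquiv m s).tsum_eq, ENNReal.tsum_sigma']
    refine tsum_congr fun t => ?_
    simp only [FirstPassagePath.weight_consEquiv]
    rw [ENNReal.ofReal_matrix_mul_apply (hAnn _ _) fun γ => hGnn m t γ β]
    simp only [fun g : FirstPassagePath m (t + 1) =>
      ENNReal.ofReal_matrix_mul_apply (hAnn ((t : ℤ) - s) α)
        fun γ => g.weight_nonneg A hAnn γ β]
    rw [Summable.tsum_finsetSum fun _ _ => ENNReal.summable]
    refine Finset.sum_congr rfl fun γ _ => ?_
    rw [ENNReal.tsum_mul_left, ih]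

end Recursion

theorem stmt1
    (r : ℕ) (hr : 1 ≤ r)
    (A : ℤ → Matrix (Fin r) (Fin r) ℝ)
    (hAz : ∀ k : ℤ, k < -1 → A k = 0)
    (hAnn : ∀ k α β, 0 ≤ A k α β)
    (G : ℕ → ℕ → Matrix (Fin r) (Fin r) ℝ)
    (hG00 : G 0 0 = A (-1))
    (hG0 : ∀ s, 1 ≤ s → G 0 s = 0)
    (hGrec : ∀ m s, G (m + 1) s = ∑' t : ℕ, A ((t : ℤ) - (s : ℤ)) * G m t) :
    ∀ α β : Fin r,
      ∑' m : ℕ, ENNReal.ofReal (G m 0 α β) =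
        ∑' k : ℕ,
          ∑' ℓ : {f : Fin (k + 2) → ℕ //
              f 0 = 1 ∧ f (Fin.last (k + 1)) = 0 ∧ ∀ t : Fin (k + 1), 1 ≤ f t.castSucc},
            ENNReal.ofReal
              (((List.ofFn fun t : Fin (k + 1) =>
                  A ((ℓ.1 t.succ : ℤ) - (ℓ.1 t.castSucc : ℤ))).prod) α β) := by
  intro α β
  exact tsum_congr fun m =>
    ofReal_recursion_eq_tsum_weight hAz hAnn hG00 hG0 hGrec m 0 α β
end

section
/- Let P and P̃ be n×n row-stochastic matrices, let π and π̃ be probability row vectors with πP = π and π̃P̃ = π̃, and suppose the matrix I − P + 𝟙π is invertible, where 𝟙 is the all-ones column vector (so 𝟙π is the rank-one matrix each of whose rows equals π); set Z := (I − P + 𝟙π)⁻¹. Then π̃ − π = π̃ (P̃ − P) Z, and consequently ‖π̃ − π‖₁ ≤ ‖P̃ − P‖ · ‖Z‖, where ‖M‖ := max_i ∑_j |M_{i,j}| denotes the maximum absolute row sum of a matrix M and ‖v‖₁ denotes the sum of the absolute values of the entries of a row vector v. -/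
open Matrix
open scoped BigOperators

/-- Maximum absolute row sum of a matrix. -/
noncomputable def rowNorm {n : ℕ} (M : Matrix (Fin n) (Fin n) ℝ) : ℝ :=
  ⨆ i, ∑ j, |M i j|

/-- The `ℓ¹` norm of a row vector times a matrix is at most the product of the norms. -/
theorem sum_abs_vecMul_le {n : ℕ} (v : Fin n → ℝ) (M : Matrix (Fin n) (Fin n) ℝ) :
    ∑ j, |(v ᵥ* M) j| ≤ (∑ i, |v i|) * rowNorm M := by
  calc ∑ j, |(v ᵥ* M) j| ≤ ∑ j, ∑ i, |v i| * |M i j| := by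
        refine Finset.sum_le_sum fun j _ => ?_
        simp only [vecMul, dotProduct, ← abs_mul]
        exact Finset.abs_sum_le_sum_abs _ _
    _ = ∑ i, |v i| * ∑ j, |M i j| := by
        rw [Finset.sum_comm]
        simp only [Finset.mul_sum]
    _ ≤ (∑ i, |v i|) * rowNorm M := by
        rw [Finset.sum_mul]
        refine Finset.sum_le_sum fun i _ => mul_le_mul_of_nonneg_left ?_ (abs_nonneg _)
        exact le_ciSup (f := fun i => ∑ j, |M i j|) (Set.finite_range _).bddAbove i

theorem rowNorm_nonneg {n : ℕ} (M : Matrix (Fin n) (Fin n) ℝ) : 0 ≤ rowNorm M :=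
  Real.iSup_nonneg fun _ => Finset.sum_nonneg fun _ _ => abs_nonneg _

/-- Multiplying a row vector by a matrix with all rows equal to `w` scales `w` by the entry sum. -/
theorem vecMul_of_const_rows {n : ℕ} (v w : Fin n → ℝ) :
    v ᵥ* (Matrix.of fun (_ : Fin n) j => w j) = (∑ i, v i) • w := by
  ext j
  simp [vecMul, dotProduct, Finset.sum_mul]

theorem stmt5 {n : ℕ}
    (P Pt : Matrix (Fin n) (Fin n) ℝ)
    (hPnn : ∀ i j, 0 ≤ P i j) (hProw : ∀ i, ∑ j, P i j = 1)
    (hPtnn : ∀ i j, 0 ≤ Pt i j) (hPtrow : ∀ i, ∑ j, Pt i j = 1)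
    (π πt : Fin n → ℝ)
    (hπnn : ∀ j, 0 ≤ π j) (hπsum : ∑ j, π j = 1) (hπ : π ᵥ* P = π)
    (hπtnn : ∀ j, 0 ≤ πt j) (hπtsum : ∑ j, πt j = 1) (hπt : πt ᵥ* Pt = πt)
    (hinv : IsUnit (1 - P + Matrix.of fun _ j => π j)) :
    πt - π = (πt ᵥ* (Pt - P)) ᵥ* (1 - P + Matrix.of fun _ j => π j)⁻¹ ∧
      ∑ j, |πt j - π j| ≤
        rowNorm (Pt - P) * rowNorm (1 - P + Matrix.of fun _ j => π j)⁻¹ := by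
  have key : πt - π = (πt ᵥ* (Pt - P)) ᵥ* (1 - P + Matrix.of fun _ j => π j)⁻¹ := by
    have h : (πt - π) ᵥ* (1 - P + Matrix.of fun _ j => π j) = πt ᵥ* (Pt - P) := by
      rw [vecMul_add, vecMul_of_const_rows, vecMul_sub, vecMul_sub, vecMul_one, sub_vecMul,
        hπ, hπt]
      simp [hπsum, hπtsum]
    rw [← h, vecMul_vecMul, Matrix.mul_nonsing_inv _ ((Matrix.isUnit_iff_isUnit_det _).1 hinv),
      vecMul_one]
  refine ⟨key, ?_⟩
  have hnorm : ∑ i, |πt i| = 1 := by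
    simpa only [abs_of_nonneg (hπtnn _)] using hπtsum
  calc ∑ j, |πt j - π j|
      = ∑ j, |((πt ᵥ* (Pt - P)) ᵥ* (1 - P + Matrix.of fun _ j => π j)⁻¹) j| := by
        rw [← key]
        rfl
    _ ≤ (∑ i, |(πt ᵥ* (Pt - P)) i|) * rowNorm (1 - P + Matrix.of fun _ j => π j)⁻¹ :=
        sum_abs_vecMul_le _ _
    _ ≤ rowNorm (Pt - P) * rowNorm (1 - P + Matrix.of fun _ j => π j)⁻¹ := by
        refine mul_le_mul_of_nonneg_right ?_ (rowNorm_nonneg _)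
        simpa only [hnorm, one_mul] using sum_abs_vecMul_le πt (Pt - P)
end

section
/- With P, E, T, U, D, Q as in the definition of the censored matrix, the censored matrix P^E = T + U (I − Q)⁻¹ D is row-stochastic. -/
open scoped BigOperators

section Censor

variable {S : Type*} [Fintype S] [DecidableEq S]

/-- The block `Q` of `P` indexed by the complement of `E = {x | p x}`. -/
def Qpart (P : Matrix S S ℝ) (p : S → Prop) [DecidablePred p] :
    Matrix {x // ¬ p x} {x // ¬ p x} ℝ :=
  Matrix.of fun a b => P a.1 b.1

/-- The censored matrix `P^E = T + U (I - Q)⁻¹ D` on `E = {x | p x}`. -/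
noncomputable def censor (P : Matrix S S ℝ) (p : S → Prop) [DecidablePred p] :
    Matrix {x // p x} {x // p x} ℝ :=
  (Matrix.of fun (a b : {x // p x}) => P a.1 b.1) +
    (Matrix.of fun (a : {x // p x}) (b : {x // ¬ p x}) => P a.1 b.1) *
      (1 - Qpart P p)⁻¹ *
    (Matrix.of fun (a : {x // ¬ p x}) (b : {x // p x}) => P a.1 b.1)

end Censor

/-- An unconditional sum of entrywise nonnegative matrices is entrywise nonnegative
(also when the family is not summable, since the sum is then zero). -/
theorem Matrix.tsum_apply_nonneg {ι m n : Type*} {A : ι → Matrix m n ℝ}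
    (hA : ∀ k i j, 0 ≤ A k i j) (i : m) (j : n) : 0 ≤ (∑' k, A k) i j := by
  by_cases h : Summable A
  · have hij : HasSum (fun k => A k i j) ((∑' k, A k) i j) :=
      Pi.hasSum.1 (Pi.hasSum.1 h.hasSum i) j
    exact hij.nonneg fun k => hA k i j
  · rw [tsum_eq_zero_of_not_summable h]
    exact le_rfl

theorem Matrix.mul_apply_nonneg {l m n : Type*} [Fintype m]
    {A : Matrix l m ℝ} {B : Matrix m n ℝ} (hA : ∀ i j, 0 ≤ A i j) (hB : ∀ i j, 0 ≤ B i j)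
    (i : l) (j : n) : 0 ≤ (A * B) i j := by
  rw [Matrix.mul_apply]
  exact Finset.sum_nonneg fun k _ => mul_nonneg (hA i k) (hB k j)

/-- Splitting the row sums of a matrix with unit row sums according to `p`. -/
theorem sum_subtype_add_sum_subtype_compl {S : Type*} [Fintype S] {P : Matrix S S ℝ}
    (p : S → Prop) [DecidablePred p] (hProw : ∀ x, ∑ y, P x y = 1) (x : S) :
    ∑ y : {y // p y}, P x y + ∑ y : {y // ¬ p y}, P x y = 1 := by
  rw [← hProw x]
  exact Fintype.sum_subtype_add_sum_subtype p (P x)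

/-- From every state outside `E` the chain returns to `E` with total probability one:
`(I - Q)⁻¹ D 1 = 1`. -/
theorem inv_one_sub_Qpart_mulVec {S : Type*} [Fintype S] [DecidableEq S] {P : Matrix S S ℝ}
    {p : S → Prop} [DecidablePred p] (hProw : ∀ x, ∑ y, P x y = 1)
    (hQinv : IsUnit (1 - Qpart P p)) :
    (1 - Qpart P p)⁻¹.mulVec
      ((Matrix.of fun (a : {x // ¬ p x}) (b : {x // p x}) => P a.1 b.1).mulVec 1) = 1 := by
  have hD : (Matrix.of fun (a : {x // ¬ p x}) (b : {x // p x}) => P a.1 b.1).mulVec 1 =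
      (1 - Qpart P p).mulVec 1 := by
    ext a
    have h := sum_subtype_add_sum_subtype_compl p hProw a.1
    rw [Matrix.sub_mulVec, Matrix.one_mulVec]
    simp only [Matrix.mulVec, dotProduct, Qpart, Matrix.of_apply, Pi.one_apply, Pi.sub_apply,
      mul_one]
    linarith
  rw [hD, Matrix.mulVec_mulVec,
    Matrix.nonsing_inv_mul _ ((Matrix.isUnit_iff_isUnit_det _).1 hQinv), Matrix.one_mulVec]

theorem stmt7 {S : Type*} [Fintype S] [DecidableEq S]
    (P : Matrix S S ℝ) (p : S → Prop) [DecidablePred p]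
    (hne : ∃ x, p x)
    (hPnn : ∀ x y, 0 ≤ P x y) (hProw : ∀ x, ∑ y, P x y = 1)
    (hQinv : IsUnit (1 - Qpart P p))
    (hNeu : (1 - Qpart P p)⁻¹ = ∑' n : ℕ, (Qpart P p) ^ n) :
    (∀ a b, 0 ≤ censor P p a b) ∧ (∀ a, ∑ b, censor P p a b = 1) := by
  refine ⟨fun a b => ?_, fun a => ?_⟩
  · have hinv : ∀ i j, 0 ≤ (1 - Qpart P p)⁻¹ i j := by
      rw [hNeu]
      exact Matrix.tsum_apply_nonneg
        fun k => Matrix.pow_apply_nonneg (fun i j => hPnn _ _) k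
    refine add_nonneg (hPnn a.1 b.1) (Matrix.mul_apply_nonneg
      (Matrix.mul_apply_nonneg ?_ hinv) ?_ a b) <;> exact fun i j => hPnn i.1 j.1
  · have hsum : ∑ b, censor P p a b = (censor P p).mulVec 1 a := by
      simp [Matrix.mulVec, dotProduct]
    rw [hsum, censor, Matrix.add_mulVec, ← Matrix.mulVec_mulVec, ← Matrix.mulVec_mulVec,
      inv_one_sub_Qpart_mulVec hProw hQinv]
    simpa [Matrix.mulVec, dotProduct] using sum_subtype_add_sum_subtype_compl p hProw a.1
end

section
/- With P, E as in the definition of the censored matrix, let π be a nonnegative row vector indexed by S with πP = π and ∑_{x∈E} π_x > 0. Then the probability row vector π^E on E defined by π^E_x := π_x / ∑_{y∈E} π_y satisfies π^E P^E = π^E; that is, the normalized restriction to E of a stationary vector of P is a stationary probability vector of the censored matrix P^E. -/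
open Matrix
open scoped BigOperators

/-- The restriction to `E = {x | p x}` of an invariant row vector of `P` is invariant under the
censored matrix. -/
theorem restrict_vecMul_censor {S : Type*} [Fintype S] [DecidableEq S]
    {P : Matrix S S ℝ} {p : S → Prop} [DecidablePred p]
    (hQinv : IsUnit (1 - Qpart P p)) {π : S → ℝ} (hπ : π ᵥ* P = π) :
    (fun a : {x // p x} => π a.1) ᵥ* censor P p = fun a => π a.1 := by
  have balance (y : S) :
      ∑ a : {x // p x}, π a.1 * P a.1 y + ∑ b : {x // ¬ p x}, π b.1 * P b.1 y = π y := by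
    rw [Fintype.sum_subtype_add_sum_subtype p fun x => π x * P x y]
    exact congrFun hπ y
  have hU : (fun a : {x // p x} => π a.1) ᵥ*
      (Matrix.of fun (a : {x // p x}) (b : {x // ¬ p x}) => P a.1 b.1) =
      (fun b : {x // ¬ p x} => π b.1) ᵥ* (1 - Qpart P p) := by
    rw [vecMul_sub, vecMul_one]
    ext b
    exact eq_sub_of_add_eq (balance b.1)
  rw [censor, vecMul_add, ← vecMul_vecMul, ← vecMul_vecMul, hU, vecMul_vecMul _ (1 - Qpart P p),
    mul_nonsing_inv _ ((isUnit_iff_isUnit_det _).mp hQinv), vecMul_one]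
  ext a
  exact balance a.1

theorem stmt9 {S : Type*} [Fintype S] [DecidableEq S]
    (P : Matrix S S ℝ) (p : S → Prop) [DecidablePred p]
    (hne : ∃ x, p x)
    (hPnn : ∀ x y, 0 ≤ P x y) (hProw : ∀ x, ∑ y, P x y = 1)
    (hQinv : IsUnit (1 - Qpart P p))
    (hNeu : (1 - Qpart P p)⁻¹ = ∑' n : ℕ, (Qpart P p) ^ n)
    (π : S → ℝ) (hπnn : ∀ x, 0 ≤ π x) (hπ : π ᵥ* P = π)
    (hmass : 0 < ∑ x : {x // p x}, π x.1) :
    (∑ a : {x // p x}, (fun a : {x // p x} => π a.1 / ∑ y : {x // p x}, π y.1) a = 1) ∧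
      (fun a : {x // p x} => π a.1 / ∑ y : {x // p x}, π y.1) ᵥ* censor P p =
        (fun a : {x // p x} => π a.1 / ∑ y : {x // p x}, π y.1) := by
  refine ⟨by rw [← Finset.sum_div, div_self hmass.ne'], ?_⟩
  have hscale : (fun a : {x // p x} => π a.1 / ∑ y : {x // p x}, π y.1) =
      (∑ y : {x // p x}, π y.1)⁻¹ • fun a : {x // p x} => π a.1 :=
    funext fun _ => div_eq_inv_mul _ _
  rw [hscale, smul_vecMul, restrict_vecMul_censor hQinv hπ]
end

section
/- Let P be a row-stochastic matrix on a finite state space S and let E_2 ⊆ E_1 ⊆ S be nonempty subsets. Assume that the censored matrices P^{E_1}, P^{E_2}, and (P^{E_1})^{E_2} are all defined, i.e., in each of the three corresponding partitions the matrix I − Q is invertible with inverse equal to the Neumann series ∑_{n≥0} Qⁿ. Then P^{E_2} = (P^{E_1})^{E_2}: censoring first to E_1 and then to E_2 yields the same matrix as censoring directly to E_2. -/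
open scoped BigOperators

section Censor

variable {S : Type*} [Fintype S] [DecidableEq S]

/-- The censored matrix is well defined: `I - Q` is invertible and its inverse is the
Neumann series `∑_{n≥0} Qⁿ`. -/
def NeumannOK (P : Matrix S S ℝ) (p : S → Prop) [DecidablePred p] : Prop :=
  IsUnit (1 - Qpart P p) ∧ (1 - Qpart P p)⁻¹ = ∑' n : ℕ, (Qpart P p) ^ n

end Censor

open Matrix

/-- Against a function that is `P`-harmonic off `{x | p x}`, the censored matrix acts as `P`. -/
theorem censor_mulVec_of_harmonic {S : Type*} [Fintype S] [DecidableEq S] (P : Matrix S S ℝ)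
    (p : S → Prop) [DecidablePred p] (hU : IsUnit (1 - Qpart P p)) (h : S → ℝ)
    (hh : ∀ x, ¬ p x → (P *ᵥ h) x = h x) (a : {x // p x}) :
    (censor P p *ᵥ fun y => h y.1) a = (P *ᵥ h) a.1 := by
  have hdet := (Matrix.isUnit_iff_isUnit_det _).1 hU
  have hsplit (x : S) : (P *ᵥ h) x =
      ∑ y : {y // p y}, P x y.1 * h y.1 + ∑ y : {y // ¬ p y}, P x y.1 * h y.1 :=
    (Fintype.sum_subtype_add_sum_subtype p fun y => P x y * h y).symm
  have hD : (Matrix.of fun (a : {x // ¬ p x}) (b : {x // p x}) => P a.1 b.1) *ᵥ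
      (fun y => h y.1) = (1 - Qpart P p) *ᵥ fun y => h y.1 := by
    ext x
    rw [Matrix.sub_mulVec, Matrix.one_mulVec, Pi.sub_apply, eq_sub_iff_add_eq, ← hh x.1 x.2,
      hsplit]
    rfl
  rw [censor, Matrix.add_mulVec, ← Matrix.mulVec_mulVec, hD, Matrix.mulVec_mulVec,
    Matrix.mul_assoc, Matrix.nonsing_inv_mul _ hdet, Matrix.mul_one, hsplit]
  rfl

/-- A function on `{x | p x}` extends to a function that is `P`-harmonic off `{x | p x}`. -/
theorem exists_harmonic_extension {S : Type*} [Fintype S] [DecidableEq S] (P : Matrix S S ℝ)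
    (p : S → Prop) [DecidablePred p] (hU : IsUnit (1 - Qpart P p)) (f : S → ℝ) :
    ∃ h : S → ℝ, (∀ x, p x → h x = f x) ∧ ∀ x, ¬ p x → (P *ᵥ h) x = h x := by
  have hdet := (Matrix.isUnit_iff_isUnit_det _).1 hU
  let d : {x // ¬ p x} → ℝ := fun x => ∑ y : {y // p y}, P x.1 y.1 * f y.1
  let g := (1 - Qpart P p)⁻¹ *ᵥ d
  have hg : (1 - Qpart P p) *ᵥ g = d := by
    rw [Matrix.mulVec_mulVec, Matrix.mul_nonsing_inv _ hdet, Matrix.one_mulVec]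
  let h : S → ℝ := fun x => if hx : p x then f x else g ⟨x, hx⟩
  have hpos (x : S) (hx : p x) : h x = f x := dif_pos hx
  have hneg (x : {x // ¬ p x}) : h x.1 = g x := dif_neg x.2
  refine ⟨h, hpos, fun x hx => ?_⟩
  have hgx := congrFun hg ⟨x, hx⟩
  rw [Matrix.sub_mulVec, Matrix.one_mulVec, Pi.sub_apply, sub_eq_iff_eq_add] at hgx
  rw [hneg ⟨x, hx⟩, hgx]
  refine (Fintype.sum_subtype_add_sum_subtype p fun y => P x y * h y).symm.trans ?_
  congr 1
  · exact Finset.sum_congr rfl fun y _ => by rw [hpos y.1 y.2]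
  · exact Finset.sum_congr rfl fun y _ => by rw [hneg y]; rfl

theorem stmt10 {S : Type*} [Fintype S] [DecidableEq S]
    (P : Matrix S S ℝ)
    (hPnn : ∀ x y, 0 ≤ P x y) (hProw : ∀ x, ∑ y, P x y = 1)
    (p1 p2 : S → Prop) [DecidablePred p1] [DecidablePred p2]
    (hsub : ∀ x, p2 x → p1 x)
    (hne2 : ∃ x, p2 x)
    (h1 : NeumannOK P p1)
    (h2 : NeumannOK P p2)
    (h12 : NeumannOK (censor P p1) (fun y : {x // p1 x} => p2 y.1)) :
    ∀ a b : {x // p2 x},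
      censor P p2 a b =
        censor (censor P p1) (fun y : {x // p1 x} => p2 y.1)
          ⟨⟨a.1, hsub a.1 a.2⟩, a.2⟩ ⟨⟨b.1, hsub b.1 b.2⟩, b.2⟩ := by
  intro a b
  obtain ⟨h, hf, hh⟩ := exists_harmonic_extension P p2 h2.1 (Pi.single b.1 1)
  have hcensor := censor_mulVec_of_harmonic P p1 h1.1 h fun x hx => hh x (mt (hsub x) hx)
  have hleft := censor_mulVec_of_harmonic P p2 h2.1 h hh a
  have hright := censor_mulVec_of_harmonic (censor P p1) (fun y => p2 y.1) h12.1
    (fun y => h y.1) (fun x hx => (hcensor x).trans (hh x.1 hx)) ⟨⟨a.1, hsub a.1 a.2⟩, a.2⟩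
  have hb : (fun y : {x // p2 x} => h y.1) = Pi.single b 1 := by
    ext y
    rw [hf y.1 y.2]
    simp [Pi.single_apply, Subtype.ext_iff]
  have hb' : (fun y : {y : {x // p1 x} // p2 y.1} => h y.1.1) =
      Pi.single ⟨⟨b.1, hsub b.1 b.2⟩, b.2⟩ 1 := by
    ext y
    rw [hf y.1.1 y.2]
    simp [Pi.single_apply, Subtype.ext_iff]
  rw [hb, Matrix.mulVec_single_one] at hleft
  rw [hb', Matrix.mulVec_single_one, hcensor] at hright
  exact hleft.trans hright.symm
end

section
/- With the definitions of R_U, Φ_D, and G_L built from the successive censored matrices P^(n), the RG-factorization holds: I − P = (I − R_U)(I − Φ_D)(I − G_L). -/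
open scoped BigOperators

/-- The `(i,j)` block (of size `r × r`) of a matrix on the state space
`L_0 ∪ ⋯ ∪ L_N` with `L_n = {(n, α) : α < r}`. -/
def PblkN (r N : ℕ) (P : Matrix (Fin (N + 1) × Fin r) (Fin (N + 1) × Fin r) ℝ)
    (i j : ℕ) : Matrix (Fin r) (Fin r) ℝ :=
  Matrix.of fun α β => if h : i < N + 1 ∧ j < N + 1 then P (⟨i, h.1⟩, α) (⟨j, h.2⟩, β) else 0

/-- Blocks of the successive censored matrices: `Pcens r N P t i j` is the `(i,j)` block of
`P^(N - t)`, obtained from `P^(N)` = `P` by `t` successive block eliminations of the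
highest remaining level. -/
noncomputable def Pcens (r N : ℕ)
    (P : Matrix (Fin (N + 1) × Fin r) (Fin (N + 1) × Fin r) ℝ) :
    ℕ → ℕ → ℕ → Matrix (Fin r) (Fin r) ℝ
  | 0 => PblkN r N P
  | t + 1 => fun i j =>
      Pcens r N P t i j +
        Pcens r N P t i (N - t) * (1 - Pcens r N P t (N - t) (N - t))⁻¹ *
          Pcens r N P t (N - t) j

/-- `Φ_k = P^(k)_{k,k}`. -/
noncomputable def PhiB (r N : ℕ)
    (P : Matrix (Fin (N + 1) × Fin r) (Fin (N + 1) × Fin r) ℝ) (k : ℕ) :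
    Matrix (Fin r) (Fin r) ℝ :=
  Pcens r N P (N - k) k k

/-- `R_{i,j} = P^(j)_{i,j} (I - Φ_j)⁻¹` for `i < j`. -/
noncomputable def Rblk (r N : ℕ)
    (P : Matrix (Fin (N + 1) × Fin r) (Fin (N + 1) × Fin r) ℝ) (i j : ℕ) :
    Matrix (Fin r) (Fin r) ℝ :=
  Pcens r N P (N - j) i j * (1 - PhiB r N P j)⁻¹

/-- `G_{i,j} = (I - Φ_i)⁻¹ P^(i)_{i,j}` for `j < i`. -/
noncomputable def Gblk (r N : ℕ)
    (P : Matrix (Fin (N + 1) × Fin r) (Fin (N + 1) × Fin r) ℝ) (i j : ℕ) :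
    Matrix (Fin r) (Fin r) ℝ :=
  (1 - PhiB r N P i)⁻¹ * Pcens r N P (N - i) i j

/-- The strictly upper block-triangular matrix `R_U`. -/
noncomputable def RU (r N : ℕ)
    (P : Matrix (Fin (N + 1) × Fin r) (Fin (N + 1) × Fin r) ℝ) :
    Matrix (Fin (N + 1) × Fin r) (Fin (N + 1) × Fin r) ℝ :=
  Matrix.of fun x y =>
    if (x.1 : ℕ) < (y.1 : ℕ) then Rblk r N P x.1 y.1 x.2 y.2 else 0

/-- The block-diagonal matrix `Φ_D`. -/
noncomputable def PhiD (r N : ℕ)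
    (P : Matrix (Fin (N + 1) × Fin r) (Fin (N + 1) × Fin r) ℝ) :
    Matrix (Fin (N + 1) × Fin r) (Fin (N + 1) × Fin r) ℝ :=
  Matrix.of fun x y =>
    if (x.1 : ℕ) = (y.1 : ℕ) then PhiB r N P x.1 x.2 y.2 else 0

/-- The strictly lower block-triangular matrix `G_L`. -/
noncomputable def GLmat (r N : ℕ)
    (P : Matrix (Fin (N + 1) × Fin r) (Fin (N + 1) × Fin r) ℝ) :
    Matrix (Fin (N + 1) × Fin r) (Fin (N + 1) × Fin r) ℝ :=
  Matrix.of fun x y =>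
    if (y.1 : ℕ) < (x.1 : ℕ) then Gblk r N P x.1 y.1 x.2 y.2 else 0

theorem Pcens_sub_eq (r N : ℕ) (P : Matrix (Fin (N + 1) × Fin r) (Fin (N + 1) × Fin r) ℝ)
    {n : ℕ} (hn : n < N) (i j : ℕ) :
    Pcens r N P (N - n) i j = Pcens r N P (N - (n + 1)) i j +
      Pcens r N P (N - (n + 1)) i (n + 1) * (1 - PhiB r N P (n + 1))⁻¹ *
        Pcens r N P (N - (n + 1)) (n + 1) j := by
  have h1 : N - n = N - (n + 1) + 1 := by omega
  have h2 : N - (N - (n + 1)) = n + 1 := by omega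
  rw [h1, Pcens, PhiB, h2]

/-- The `(i,j)` block of `I - R_U`. -/
noncomputable def upperBlk (r N : ℕ)
    (P : Matrix (Fin (N + 1) × Fin r) (Fin (N + 1) × Fin r) ℝ) (i j : ℕ) :
    Matrix (Fin r) (Fin r) ℝ :=
  if i = j then 1 else if i < j then -Rblk r N P i j else 0

/-- The `(i,j)` block of `I - G_L`. -/
noncomputable def lowerBlk (r N : ℕ)
    (P : Matrix (Fin (N + 1) × Fin r) (Fin (N + 1) × Fin r) ℝ) (i j : ℕ) :
    Matrix (Fin r) (Fin r) ℝ :=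
  if i = j then 1 else if j < i then -Gblk r N P i j else 0

/-- The `(i,j)` block of the factorization of `I - P^(n)`, summed up to level `n`. -/
theorem sum_upperBlk_mul_lowerBlk (r N : ℕ)
    (P : Matrix (Fin (N + 1) × Fin r) (Fin (N + 1) × Fin r) ℝ)
    (hunit : ∀ n, 1 ≤ n → n ≤ N → IsUnit (1 - PhiB r N P n))
    {i j n : ℕ} (hmn : max i j ≤ n) (hnN : n ≤ N) :
    ∑ k ∈ Finset.range (n + 1),
        upperBlk r N P i k * (1 - PhiB r N P k) * lowerBlk r N P k j =
      (if i = j then 1 else 0) - Pcens r N P (N - n) i j := by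
  have hdet : ∀ n, 1 ≤ n → n ≤ N → IsUnit (1 - PhiB r N P n).det := fun n h1 h2 =>
    (Matrix.isUnit_iff_isUnit_det _).1 (hunit n h1 h2)
  induction n, hmn using Nat.le_induction with
  | base =>
    rw [Finset.sum_range_succ, Finset.sum_eq_zero, zero_add]
    · rcases lt_trichotomy i j with h | rfl | h
      · have hd := hdet j (by omega) (by omega)
        simp [upperBlk, lowerBlk, h, h.ne, max_eq_right h.le, Rblk, mul_assoc,
          Matrix.nonsing_inv_mul _ hd]
      · simp [upperBlk, lowerBlk, PhiB]
      · have hd := hdet i (by omega) (by omega)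
        simp [upperBlk, lowerBlk, h, h.ne', max_eq_left h.le, Gblk,
          Matrix.mul_nonsing_inv_cancel_left _ _ hd]
    · intro k hk
      rw [Finset.mem_range, lt_max_iff] at hk
      rcases hk with hk | hk
      · simp [upperBlk, hk.ne', hk.not_gt]
      · simp [lowerBlk, hk.ne, hk.not_gt]
  | succ n hmn ih =>
    have hd := hdet (n + 1) (by omega) hnN
    have hi : i < n + 1 := by omega
    have hj : j < n + 1 := by omega
    rw [Finset.sum_range_succ, ih (by omega), Pcens_sub_eq r N P (by omega)]
    simp only [upperBlk, lowerBlk, hi, hj, hi.ne, hj.ne', if_true, if_false, Rblk, Gblk,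
      neg_mul, mul_neg, neg_neg, Matrix.nonsing_inv_mul_cancel_right _ _ hd, mul_assoc]
    abel

theorem one_sub_RU_apply (r N : ℕ)
    (P : Matrix (Fin (N + 1) × Fin r) (Fin (N + 1) × Fin r) ℝ) (x y : Fin (N + 1) × Fin r) :
    (1 - RU r N P) x y = upperBlk r N P x.1 y.1 x.2 y.2 := by
  obtain ⟨i, a⟩ := x
  obtain ⟨j, b⟩ := y
  rcases lt_trichotomy i j with h | rfl | h
  · simp [RU, upperBlk, h, h.ne, Fin.val_inj]
  · simp [RU, upperBlk, Matrix.one_apply]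
  · simp [RU, upperBlk, h.ne', h.not_gt, Fin.val_inj]

theorem one_sub_PhiD_apply (r N : ℕ)
    (P : Matrix (Fin (N + 1) × Fin r) (Fin (N + 1) × Fin r) ℝ) (x y : Fin (N + 1) × Fin r) :
    (1 - PhiD r N P) x y = if x.1 = y.1 then (1 - PhiB r N P x.1) x.2 y.2 else 0 := by
  obtain ⟨i, a⟩ := x
  obtain ⟨j, b⟩ := y
  by_cases h : i = j
  · simp [PhiD, Matrix.one_apply, h]
  · simp [PhiD, h, Fin.val_inj]

theorem one_sub_GLmat_apply (r N : ℕ)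
    (P : Matrix (Fin (N + 1) × Fin r) (Fin (N + 1) × Fin r) ℝ) (x y : Fin (N + 1) × Fin r) :
    (1 - GLmat r N P) x y = lowerBlk r N P x.1 y.1 x.2 y.2 := by
  obtain ⟨i, a⟩ := x
  obtain ⟨j, b⟩ := y
  rcases lt_trichotomy i j with h | rfl | h
  · simp [GLmat, lowerBlk, h.ne, h.not_gt, Fin.val_inj]
  · simp [GLmat, lowerBlk, Matrix.one_apply]
  · simp [GLmat, lowerBlk, h, h.ne', Fin.val_inj]

theorem stmt11 (r N : ℕ) (hr : 1 ≤ r)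
    (P : Matrix (Fin (N + 1) × Fin r) (Fin (N + 1) × Fin r) ℝ)
    (hPnn : ∀ x y, 0 ≤ P x y) (hProw : ∀ x, ∑ y, P x y = 1)
    (hinv : ∀ n, 1 ≤ n → n ≤ N →
      IsUnit (1 - Pcens r N P (N - n) n n) ∧
      (1 - Pcens r N P (N - n) n n)⁻¹ = ∑' k : ℕ, (Pcens r N P (N - n) n n) ^ k) :
    1 - P = (1 - RU r N P) * (1 - PhiD r N P) * (1 - GLmat r N P) := by
  have hsum := fun i j : Fin (N + 1) => sum_upperBlk_mul_lowerBlk r N P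
    (fun n h1 h2 => (hinv n h1 h2).1) (i := i) (j := j) (n := N) (by omega) le_rfl
  ext ⟨i, a⟩ ⟨j, b⟩
  have hij := congrFun (congrFun (hsum i j) a) b
  rw [Finset.sum_range, Matrix.sum_apply] at hij
  have hlhs : (1 - P) (i, a) (j, b) =
      ((if (i : ℕ) = j then 1 else 0) - Pcens r N P (N - N) i j :
        Matrix (Fin r) (Fin r) ℝ) a b := by
    by_cases h : i = j <;>
      simp [Pcens, PblkN, Matrix.one_apply, h, Fin.val_inj, i.is_le, j.is_le.not_gt]
  rw [hlhs, ← hij]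
  simp only [Matrix.mul_apply, one_sub_RU_apply, one_sub_PhiD_apply, one_sub_GLmat_apply,
    Fintype.sum_prod_type]
  refine Finset.sum_congr rfl fun k _ => Finset.sum_congr rfl fun c _ => ?_
  congr 1
  rw [Finset.sum_eq_single k (fun l _ hl => by simp [hl]) (by simp)]
  simp
end

section
/- Assume additionally that I − Φ_j is invertible for every j ∈ {1, …, N}. If π = (π_0, π_1, …, π_N) is a row vector, partitioned according to levels, with π(I − P) = 0, then π_0 (I − Φ_0) = 0 and π_j = ∑_{i=0}^{j−1} π_i R_{i,j} for every j = 1, …, N. -/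
open Matrix
open scoped BigOperators

/-- The level-`i` block of a row vector on `L_0 ∪ ⋯ ∪ L_N`. -/
def blkv (r N : ℕ) (π : Fin (N + 1) × Fin r → ℝ) (i : ℕ) : Fin r → ℝ :=
  fun α => if h : i < N + 1 then π (⟨i, h⟩, α) else 0

theorem eq_zero_of_vecMul_one_sub_GLmat (r N : ℕ)
    (P : Matrix (Fin (N + 1) × Fin r) (Fin (N + 1) × Fin r) ℝ)
    (u : Fin (N + 1) × Fin r → ℝ) (hu : u ᵥ* (1 - GLmat r N P) = 0) : u = 0 := by
  rw [Matrix.vecMul_sub, Matrix.vecMul_one, sub_eq_zero] at hu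
  have key : ∀ j : Fin (N + 1), ∀ β, u (j, β) = 0 := by
    intro j
    induction j using WellFoundedGT.induction with
    | ind j ih =>
      intro β
      rw [hu]
      refine Finset.sum_eq_zero fun x _ => ?_
      by_cases hx : (j : ℕ) < (x.1 : ℕ)
      · have h0 : u x = 0 := ih x.1 hx x.2
        rw [h0, zero_mul]
      · have h0 : GLmat r N P x (j, β) = 0 := if_neg hx
        exact mul_eq_zero_of_right _ h0
  funext x
  exact key x.1 x.2

theorem blkv_vecMul_PhiD (r N : ℕ)
    (P : Matrix (Fin (N + 1) × Fin r) (Fin (N + 1) × Fin r) ℝ)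
    (w : Fin (N + 1) × Fin r → ℝ) {j : ℕ} (hj : j ≤ N) :
    blkv r N (w ᵥ* PhiD r N P) j = blkv r N w j ᵥ* PhiB r N P j := by
  have hj' : j < N + 1 := Nat.lt_succ_of_le hj
  funext β
  simp only [blkv, hj', dite_true, Matrix.vecMul, dotProduct, PhiD, Matrix.of_apply]
  rw [Fintype.sum_prod_type, Finset.sum_eq_single (⟨j, hj'⟩ : Fin (N + 1))]
  · simp
  · intro i _ hi
    have hij : (i : ℕ) ≠ j := fun h => hi (Fin.ext h)
    simp [hij]
  · simp

theorem blkv_vecMul_RU (r N : ℕ)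
    (P : Matrix (Fin (N + 1) × Fin r) (Fin (N + 1) × Fin r) ℝ)
    (w : Fin (N + 1) × Fin r → ℝ) {j : ℕ} (hj : j ≤ N) :
    blkv r N (w ᵥ* RU r N P) j =
      ∑ i ∈ Finset.range j, blkv r N w i ᵥ* Rblk r N P i j := by
  have hj' : j < N + 1 := Nat.lt_succ_of_le hj
  funext β
  have hfil : Finset.range j =
      (Finset.range (N + 1)).filter (fun i => i < j) := by
    ext i
    simp only [Finset.mem_filter, Finset.mem_range]
    omega
  rw [hfil, Finset.sum_filter, Finset.sum_range, Finset.sum_apply]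
  simp only [blkv, hj', dite_true, Matrix.vecMul, dotProduct, RU, Matrix.of_apply]
  rw [Fintype.sum_prod_type]
  refine Finset.sum_congr rfl fun i _ => ?_
  by_cases hij : (i : ℕ) < j
  · simp [hij, blkv, Matrix.vecMul, dotProduct, i.isLt, -Order.lt_add_one_iff]
  · simp [hij]

theorem blkv_sub (r N : ℕ) (v w : Fin (N + 1) × Fin r → ℝ) (j : ℕ) :
    blkv r N (v - w) j = blkv r N v j - blkv r N w j := by
  funext β
  by_cases hj : j < N + 1 <;> simp [blkv, hj]

theorem blkv_zero (r N : ℕ) (j : ℕ) : blkv r N 0 j = 0 := by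
  funext β
  simp [blkv]

theorem stmt12 (r N : ℕ) (hr : 1 ≤ r)
    (P : Matrix (Fin (N + 1) × Fin r) (Fin (N + 1) × Fin r) ℝ)
    (hPnn : ∀ x y, 0 ≤ P x y) (hProw : ∀ x, ∑ y, P x y = 1)
    (hinv : ∀ n, 1 ≤ n → n ≤ N →
      IsUnit (1 - Pcens r N P (N - n) n n) ∧
      (1 - Pcens r N P (N - n) n n)⁻¹ = ∑' k : ℕ, (Pcens r N P (N - n) n n) ^ k)
    (hPhiInv : ∀ j, 1 ≤ j → j ≤ N → IsUnit (1 - PhiB r N P j))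
    (hRG : 1 - P = (1 - RU r N P) * (1 - PhiD r N P) * (1 - GLmat r N P)) :
    ∀ π : Fin (N + 1) × Fin r → ℝ, π ᵥ* (1 - P) = 0 →
      blkv r N π 0 ᵥ* (1 - PhiB r N P 0) = 0 ∧
      ∀ j, 1 ≤ j → j ≤ N →
        blkv r N π j = ∑ i ∈ Finset.range j, blkv r N π i ᵥ* Rblk r N P i j := by
  intro π hπ
  rw [hRG, ← Matrix.vecMul_vecMul, ← Matrix.vecMul_vecMul] at hπ
  have hu := eq_zero_of_vecMul_one_sub_GLmat r N P _ hπ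
  have hw : ∀ j ≤ N,
      (blkv r N π j - ∑ i ∈ Finset.range j, blkv r N π i ᵥ* Rblk r N P i j) ᵥ*
        (1 - PhiB r N P j) = 0 := by
    intro j hj
    have h := congrArg (fun v => blkv r N v j) hu
    simp only [Matrix.vecMul_sub, Matrix.vecMul_one, blkv_sub, blkv_zero,
      blkv_vecMul_PhiD r N P _ hj, blkv_vecMul_RU r N P _ hj] at h
    rw [Matrix.vecMul_sub, Matrix.vecMul_one]
    exact h
  refine ⟨by simpa using hw 0 (Nat.zero_le N), fun j hj1 hjN => ?_⟩
  have hinj := Matrix.vecMul_injective_of_isUnit (hPhiInv j hj1 hjN)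
  refine sub_eq_zero.1 (hinj ?_)
  simpa only [Matrix.zero_vecMul] using hw j hjN
end
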